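/- With $V$ and the weighted backward shift $B$ on $\ell^2(V)$ as in the tree construction (weights $\mu_1$ on the $\mathbb{Z}$-spine and $\mu_2$ on the finite branches, $1 < |\mu_1| < |\mu_2|$): if $f \in \ell^2(V)$ satisfies $f(-k,j) \ne 0$ for some branch vertex $(-k,j)$, then $f$ is not chain recurrent for $B$. Hence $CR(B) = \overline{\operatorname{span}}\{e_n : n \in \mathbb{Z}\}$. -/

import Mathlib

/-- A δ-chain for `T` from `f` to `g`: a finite sequence `(u l)_{l=0}^m`, `m ≥ 1`,
with `u 0 = f`, `u m = g`, and `‖u l - T (u (l-1))‖ < δ` for `1 ≤ l ≤ m`. -/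
def IsDeltaChain {X : Type*} [NormedAddCommGroup X] [NormedSpace ℂ X]
    (T : X →L[ℂ] X) (δ : ℝ) (f g : X) : Prop :=
  ∃ (m : ℕ) (u : ℕ → X), 1 ≤ m ∧ u 0 = f ∧ u m = g ∧
    ∀ l, 1 ≤ l → l ≤ m → ‖u l - T (u (l - 1))‖ < δ

/-- `f` is a chain recurrent vector for `T`. -/
def ChainRecVec {X : Type*} [NormedAddCommGroup X] [NormedSpace ℂ X]
    (T : X →L[ℂ] X) (f : X) : Prop :=
  ∀ δ : ℝ, 0 < δ → IsDeltaChain T δ f f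

open scoped ENNReal

/-- Branch vertices `(-k, j)` of the tree, encoded by pairs `(k, j)` with `1 ≤ j ≤ k`. -/
abbrev TreeBranch : Type := {p : ℕ × ℕ // 1 ≤ p.2 ∧ p.2 ≤ p.1}

/-- The tree `V = ℤ ∪ {(-k,j) : k ∈ ℕ, 1 ≤ j ≤ k}`. -/
abbrev TreeV : Type := ℤ ⊕ TreeBranch

/-- The canonical unit vectors of `ℓ²(V)`. -/
noncomputable def eV (v : TreeV) : lp (fun _ : TreeV => ℂ) 2 := lp.single 2 v 1

section Abstract
variable {X : Type*} [NormedAddCommGroup X] [NormedSpace ℂ X]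

/-- `f` can be steered to `0` by arbitrarily small errors. -/
def ToZero (T : X →L[ℂ] X) (f : X) : Prop :=
  ∀ δ : ℝ, 0 < δ → ∃ (N : ℕ) (u : ℕ → X), u 0 = f ∧ (∀ l, N ≤ l → u l = 0) ∧
    ∀ l, ‖u (l + 1) - T (u l)‖ < δ

/-- `f` can be reached from `0` by arbitrarily small errors (time reversed). -/
def FromZero (T : X →L[ℂ] X) (f : X) : Prop :=
  ∀ δ : ℝ, 0 < δ → ∃ (N : ℕ) (u : ℕ → X), u 0 = f ∧ (∀ l, N ≤ l → u l = 0) ∧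
    ∀ l, ‖u l - T (u (l + 1))‖ < δ

theorem ToZero.zero (T : X →L[ℂ] X) : ToZero T 0 :=
  fun δ hδ => ⟨0, fun _ => 0, rfl, fun _ _ => rfl, fun l => by simpa using hδ⟩

theorem FromZero.zero (T : X →L[ℂ] X) : FromZero T 0 :=
  fun δ hδ => ⟨0, fun _ => 0, rfl, fun _ _ => rfl, fun l => by simpa using hδ⟩

theorem ToZero.add {T : X →L[ℂ] X} {f g : X} (hf : ToZero T f) (hg : ToZero T g) :
    ToZero T (f + g) := by
  intro δ hδ
  obtain ⟨N, u, u0, uN, hu⟩ := hf (δ / 2) (by positivity)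
  obtain ⟨M, v, v0, vM, hv⟩ := hg (δ / 2) (by positivity)
  refine ⟨max N M, fun l => u l + v l, by simp [u0, v0], fun l hl => ?_, fun l => ?_⟩
  · simp [uN l (le_trans (le_max_left _ _) hl), vM l (le_trans (le_max_right _ _) hl)]
  · have : u (l + 1) + v (l + 1) - T (u l + v l)
        = (u (l + 1) - T (u l)) + (v (l + 1) - T (v l)) := by rw [map_add]; abel
    simp only [this]
    have := norm_add_le (u (l + 1) - T (u l)) (v (l + 1) - T (v l))
    have := hu l
    have := hv l
    linarith

theorem FromZero.add {T : X →L[ℂ] X} {f g : X} (hf : FromZero T f) (hg : FromZero T g) :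
    FromZero T (f + g) := by
  intro δ hδ
  obtain ⟨N, u, u0, uN, hu⟩ := hf (δ / 2) (by positivity)
  obtain ⟨M, v, v0, vM, hv⟩ := hg (δ / 2) (by positivity)
  refine ⟨max N M, fun l => u l + v l, by simp [u0, v0], fun l hl => ?_, fun l => ?_⟩
  · simp [uN l (le_trans (le_max_left _ _) hl), vM l (le_trans (le_max_right _ _) hl)]
  · have : u l + v l - T (u (l + 1) + v (l + 1))
        = (u l - T (u (l + 1))) + (v l - T (v (l + 1))) := by rw [map_add]; abel
    simp only [this]
    have := norm_add_le (u l - T (u (l + 1))) (v l - T (v (l + 1)))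
    have := hu l
    have := hv l
    linarith

theorem scale_aux (c : ℂ) {δ a : ℝ} (hδ : 0 < δ) (ha : 0 ≤ a) (h : a < δ / (‖c‖ + 1)) :
    ‖c‖ * a < δ := by
  have hc := norm_nonneg c
  rw [lt_div_iff₀ (by positivity)] at h
  nlinarith

theorem ToZero.smul {T : X →L[ℂ] X} {f : X} (c : ℂ) (hf : ToZero T f) : ToZero T (c • f) := by
  intro δ hδ
  obtain ⟨N, u, u0, uN, hu⟩ := hf (δ / (‖c‖ + 1)) (by positivity)
  refine ⟨N, fun l => c • u l, by simp [u0], fun l hl => by simp [uN l hl], fun l => ?_⟩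
  simp only [map_smul, ← smul_sub, norm_smul]
  exact scale_aux c hδ (norm_nonneg _) (hu l)

theorem FromZero.smul {T : X →L[ℂ] X} {f : X} (c : ℂ) (hf : FromZero T f) :
    FromZero T (c • f) := by
  intro δ hδ
  obtain ⟨N, u, u0, uN, hu⟩ := hf (δ / (‖c‖ + 1)) (by positivity)
  refine ⟨N, fun l => c • u l, by simp [u0], fun l hl => by simp [uN l hl], fun l => ?_⟩
  simp only [map_smul, ← smul_sub, norm_smul]
  exact scale_aux c hδ (norm_nonneg _) (hu l)

theorem ToZero.of_map {T : X →L[ℂ] X} {f : X} (hf : ToZero T (T f)) : ToZero T f := by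
  intro δ hδ
  obtain ⟨N, u, u0, uN, hu⟩ := hf δ hδ
  refine ⟨N + 1, fun l => Nat.casesOn l f u, rfl, fun l hl => ?_, fun l => ?_⟩
  · cases l with
    | zero => omega
    | succ l => exact uN l (by omega)
  · cases l with
    | zero => simpa [u0] using hδ
    | succ l => exact hu l

theorem ToZero.of_small {T : X →L[ℂ] X} {f : X}
    (h : ∀ ε : ℝ, 0 < ε → ∃ (N : ℕ) (d : X), ‖d‖ < ε ∧ (T ^ N) (f - d) = 0) : ToZero T f := by
  intro δ hδ
  obtain ⟨N, d, hd, hN⟩ := h (δ / (‖T‖ + 1)) (by positivity)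
  have hz : ∀ l, N ≤ l → (T ^ l) (f - d) = 0 := by
    intro l hl
    obtain ⟨r, rfl⟩ := Nat.exists_eq_add_of_le' hl
    rw [pow_add, mul_apply_eq_comp, hN, map_zero]
  refine ⟨N + 1, fun l => if l = 0 then f else (T ^ l) (f - d), by simp, fun l hl => ?_,
    fun l => ?_⟩
  · simp only [show l ≠ 0 by omega, if_false]
    exact hz l (by omega)
  · by_cases hl : l = 0
    · subst hl
      simp only [zero_add, one_ne_zero, if_false, if_true, pow_one, map_sub]
      rw [sub_sub_cancel_left, norm_neg]
      refine lt_of_le_of_lt (T.le_opNorm d) ?_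
      have h0 := norm_nonneg T
      rw [lt_div_iff₀ (by positivity)] at hd
      have := norm_nonneg d
      nlinarith
    · simp only [hl, if_false, Nat.succ_ne_zero]
      rw [pow_succ', mul_apply_eq_comp, sub_self, norm_zero]
      exact hδ

theorem chainRec_of_zero {T : X →L[ℂ] X} {f : X} (h1 : ToZero T f) (h2 : FromZero T f) :
    ChainRecVec T f := by
  intro δ hδ
  obtain ⟨N, u, u0, uN, hu⟩ := h1 δ hδ
  obtain ⟨M, v, v0, vM, hv⟩ := h2 δ hδ
  set K := N + M + 1 with hK
  refine ⟨2 * K, fun l => if l ≤ K then u l else v (2 * K - l), by omega, by simp [u0], ?_, ?_⟩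
  · simp only [show ¬ (2 * K ≤ K) by omega, if_false, Nat.sub_self, v0]
  · intro l hl1 hl2
    obtain ⟨l, rfl⟩ := Nat.exists_eq_add_of_le' hl1
    simp only [Nat.add_sub_cancel]
    by_cases h : l + 1 ≤ K
    · simp only [h, show l ≤ K by omega, if_true]
      exact hu l
    · have e : (if l ≤ K then u l else v (2 * K - l)) = v (2 * K - (l + 1) + 1) := by
        split_ifs with h'
        · rw [uN l (by omega), vM _ (by omega)]
        · congr 1; omega
      simp only [h, if_false, e]
      exact hv _

theorem chainRec_of_mem_closure {T : X →L[ℂ] X} {S : Set X} (hS : ∀ g ∈ S, ChainRecVec T g)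
    {f : X} (hf : f ∈ closure S) : ChainRecVec T f := by
  intro δ hδ
  have hT := norm_nonneg T
  obtain ⟨g, hg, hfg⟩ := Metric.mem_closure_iff.1 hf (δ / 2 / (‖T‖ + 1)) (by positivity)
  rw [dist_eq_norm, lt_div_iff₀ (by positivity)] at hfg
  obtain ⟨m, u, hm, u0, um, hu⟩ := hS g hg (δ / 2) (by positivity)
  refine ⟨m, fun l => if l = 0 ∨ l = m then f else u l, hm, by simp, by simp, ?_⟩
  have key : ∀ l, ‖(if l = 0 ∨ l = m then f else u l) - u l‖ ≤ ‖f - g‖ := by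
    intro l
    split_ifs with h
    · rcases h with rfl | rfl
      · rw [u0]
      · rw [um]
    · simp
  intro l h1 h2
  simp only
  set w : ℕ → X := fun l => if l = 0 ∨ l = m then f else u l with hw
  change ‖w l - T (w (l - 1))‖ < δ
  have e : w l - T (w (l - 1)) = (u l - T (u (l - 1))) + (w l - u l)
      - T (w (l - 1) - u (l - 1)) := by rw [map_sub]; abel
  rw [e]
  have a1 := norm_sub_le ((u l - T (u (l - 1))) + (w l - u l)) (T (w (l - 1) - u (l - 1)))
  have a2 := norm_add_le (u l - T (u (l - 1))) (w l - u l)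
  have a3 := T.le_opNorm (w (l - 1) - u (l - 1))
  have a4 : ‖T‖ * ‖w (l - 1) - u (l - 1)‖ ≤ ‖T‖ * ‖f - g‖ :=
    mul_le_mul_of_nonneg_left (key (l - 1)) hT
  have a5 : ‖w l - u l‖ ≤ ‖f - g‖ := key l
  have a6 := hu l h1 h2
  nlinarith

end Abstract

theorem eV_apply (v w : TreeV) : eV v w = if w = v then 1 else 0 := by
  rw [eV, lp.single_apply, Pi.single_apply]

theorem eV_norm (v : TreeV) : ‖eV v‖ = 1 := by
  rw [eV, lp.norm_single (by norm_num)]; simp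

theorem eV_hasSum (f : lp (fun _ : TreeV => ℂ) 2) : HasSum (fun v => f v • eV v) f := by
  have h := lp.hasSum_single (p := 2) (by norm_num) f
  convert h using 2 with v
  rw [eV, ← lp.single_smul]
  simp

theorem clm_ext_eV (a b : lp (fun _ : TreeV => ℂ) 2 →L[ℂ] ℂ) (h : ∀ v, a (eV v) = b (eV v)) :
    a = b := by
  ext f
  have h1 := (eV_hasSum f).mapL a
  have h2 := (eV_hasSum f).mapL b
  simp only [map_smul, h] at h1 h2
  exact h1.unique h2

theorem stmt_8 (μ1 μ2 : ℂ) (hμ1 : 1 < ‖μ1‖) (hμ12 : ‖μ1‖ < ‖μ2‖)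
    (B : lp (fun _ : TreeV => ℂ) 2 →L[ℂ] lp (fun _ : TreeV => ℂ) 2)
    (hspine : ∀ n : ℤ, B (eV (Sum.inl n)) = μ1 • eV (Sum.inl (n - 1)))
    (hbranch : ∀ (k j : ℕ) (h1 : 2 ≤ j) (h2 : j ≤ k),
      B (eV (Sum.inr ⟨(k, j), ⟨show 1 ≤ j by omega, h2⟩⟩)) =
        μ2 • eV (Sum.inr ⟨(k, j - 1), ⟨show 1 ≤ j - 1 by omega, show j - 1 ≤ k by omega⟩⟩))
    (hjoin : ∀ (k : ℕ) (hk : 1 ≤ k),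
      B (eV (Sum.inr ⟨(k, 1), ⟨le_refl 1, hk⟩⟩)) = μ2 • eV (Sum.inl (-(k : ℤ)))) :
    (∀ f : lp (fun _ : TreeV => ℂ) 2, (∃ p : TreeBranch, f (Sum.inr p) ≠ 0) →
        ¬ ChainRecVec B f) ∧
    {f : lp (fun _ : TreeV => ℂ) 2 | ChainRecVec B f} =
      closure (Submodule.span ℂ (Set.range fun n : ℤ => eV (Sum.inl n)) :
        Set (lp (fun _ : TreeV => ℂ) 2)) := by
  set E := lp (fun _ : TreeV => ℂ) 2 with hE
  -- coordinates of `B f` on the branches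
  have hcoord : ∀ (k j : ℕ) (h1 : 1 ≤ j) (h2 : j + 1 ≤ k) (f : E),
      B f (Sum.inr ⟨(k, j), ⟨h1, show j ≤ k by omega⟩⟩)
        = μ2 * f (Sum.inr ⟨(k, j + 1), ⟨show 1 ≤ j + 1 by omega, h2⟩⟩) := by
    intro k j h1 h2 f
    have := clm_ext_eV
      ((lp.evalCLM ℂ (fun _ : TreeV => ℂ) 2 (Sum.inr ⟨(k, j), ⟨h1, show j ≤ k by omega⟩⟩)).comp B)
      (μ2 • lp.evalCLM ℂ (fun _ : TreeV => ℂ) 2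
        (Sum.inr ⟨(k, j + 1), ⟨show 1 ≤ j + 1 by omega, h2⟩⟩)) ?_
    · exact DFunLike.congr_fun this f
    · intro v
      change B (eV v) (Sum.inr ⟨(k, j), ⟨h1, show j ≤ k by omega⟩⟩)
        = μ2 * eV v (Sum.inr ⟨(k, j + 1), ⟨show 1 ≤ j + 1 by omega, h2⟩⟩)
      rcases v with n | ⟨⟨k', j'⟩, h1', h2'⟩
      · rw [hspine]
        simp [eV_apply]
      · simp only at h1' h2'
        by_cases hj : j' = 1
        · subst hj
          rw [hjoin k' h2']
          simp [eV_apply]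
          omega
        · rw [hbranch k' j' (by omega) h2']
          have : (k = k' ∧ j = j' - 1) ↔ (k = k' ∧ j + 1 = j') := by omega
          simp [eV_apply, this]
  have htop : ∀ (k : ℕ) (h1 : 1 ≤ k) (f : E),
      B f (Sum.inr ⟨(k, k), ⟨h1, le_refl k⟩⟩) = 0 := by
    intro k h1 f
    have := clm_ext_eV
      ((lp.evalCLM ℂ (fun _ : TreeV => ℂ) 2 (Sum.inr ⟨(k, k), ⟨h1, le_refl k⟩⟩)).comp B) 0 ?_
    · exact DFunLike.congr_fun this f
    · intro v
      change B (eV v) (Sum.inr ⟨(k, k), ⟨h1, le_refl k⟩⟩) = 0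
      rcases v with n | ⟨⟨k', j'⟩, h1', h2'⟩
      · rw [hspine]
        simp [eV_apply]
      · simp only at h1' h2'
        by_cases hj : j' = 1
        · subst hj
          rw [hjoin k' h2']
          simp [eV_apply]
        · rw [hbranch k' j' (by omega) h2']
          have : ¬ (k = k' ∧ k = j' - 1) := by omega
          simp [eV_apply, this]
  -- quantitative estimate along a closed chain
  have hbound : ∀ i : ℕ, ∃ C : ℝ, 0 ≤ C ∧ ∀ (k j : ℕ) (h1 : 1 ≤ j) (h2 : j ≤ k), k = j + i →
      ∀ (δ : ℝ) (m : ℕ) (u : ℕ → E), 1 ≤ m → u 0 = u m →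
      (∀ l, 1 ≤ l → l ≤ m → ‖u l - B (u (l - 1))‖ < δ) →
      ∀ l, l ≤ m → ‖u l (Sum.inr ⟨(k, j), ⟨h1, h2⟩⟩)‖ ≤ C * δ := by
    intro i
    have red : ∀ (C : ℝ) (v : TreeV) (m : ℕ) (u : ℕ → E), 1 ≤ m → u 0 = u m →
        (∀ l, 1 ≤ l → l ≤ m → ‖u l v‖ ≤ C) → ∀ l, l ≤ m → ‖u l v‖ ≤ C := by
      intro C v m u hm h0 h l hl
      rcases Nat.eq_zero_or_pos l with rfl | h'
      · rw [h0]; exact h m hm le_rfl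
      · exact h l h' hl
    have coordle : ∀ (x : E) (v : TreeV), ‖x v‖ ≤ ‖x‖ := fun x v =>
      lp.norm_apply_le_norm (by norm_num) x v
    induction i with
    | zero =>
      refine ⟨1, by norm_num, ?_⟩
      intro k j h1 h2 hk δ m u hm h0 hu
      obtain rfl : k = j := by omega
      refine red _ _ m u hm h0 fun l hl1 hl2 => ?_
      have a := coordle (u l - B (u (l - 1))) (Sum.inr ⟨(k, k), ⟨h1, h2⟩⟩)
      rw [lp.coeFn_sub, Pi.sub_apply, htop k h1, sub_zero] at a
      have := hu l hl1 hl2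
      linarith
    | succ i ih =>
      obtain ⟨C, hC, ih⟩ := ih
      refine ⟨‖μ2‖ * C + 1, by positivity, ?_⟩
      intro k j h1 h2 hk δ m u hm h0 hu
      refine red _ _ m u hm h0 fun l hl1 hl2 => ?_
      have a := coordle (u l - B (u (l - 1))) (Sum.inr ⟨(k, j), ⟨h1, h2⟩⟩)
      rw [lp.coeFn_sub, Pi.sub_apply, hcoord k j h1 (by omega)] at a
      have b := ih k (j + 1) (by omega) (by omega) (by omega) δ m u hm h0 hu (l - 1) (by omega)
      have c := hu l hl1 hl2
      have d := norm_le_norm_sub_add (u l (Sum.inr ⟨(k, j), ⟨h1, h2⟩⟩))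
        (μ2 * u (l - 1) (Sum.inr ⟨(k, j + 1), ⟨by omega, by omega⟩⟩))
      rw [norm_mul] at d
      have e := mul_le_mul_of_nonneg_left b (norm_nonneg μ2)
      linarith
  have part1 : ∀ f : E, (∃ p : TreeBranch, f (Sum.inr p) ≠ 0) → ¬ ChainRecVec B f := by
    rintro f ⟨⟨⟨k, j⟩, h1, h2⟩, hne⟩ hrec
    simp only at h1 h2
    obtain ⟨C, hC, hb⟩ := hbound (k - j)
    have hpos : 0 < ‖f (Sum.inr ⟨(k, j), ⟨h1, h2⟩⟩)‖ := norm_pos_iff.2 hne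
    obtain ⟨m, u, hm, u0, um, hu⟩ :=
      hrec (‖f (Sum.inr ⟨(k, j), ⟨h1, h2⟩⟩)‖ / (C + 1)) (by positivity)
    have := hb k j h1 h2 (by omega) _ m u hm (u0.trans um.symm) hu 0 (by omega)
    rw [u0, mul_div_assoc', le_div_iff₀ (by positivity)] at this
    nlinarith
  refine ⟨part1, ?_⟩
  -- the spine vectors can be steered to zero and reached from zero
  have hm1 : μ1 ≠ 0 := by rintro rfl; simp at hμ1; linarith
  have hm2 : μ2 ≠ 0 := by rintro rfl; simp at hμ12; linarith [norm_nonneg μ1]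
  have hpowspine : ∀ (i : ℕ) (n : ℤ),
      (B ^ i) (eV (Sum.inl n)) = μ1 ^ i • eV (Sum.inl (n - i)) := by
    intro i
    induction i with
    | zero => intro n; simp
    | succ i ih =>
      intro n
      rw [pow_succ, mul_apply_eq_comp, hspine, map_smul, ih, smul_smul, pow_succ']
      congr 3
      push_cast; ring
  have hpowbranch : ∀ (j k : ℕ) (h1 : 1 ≤ j) (h2 : j ≤ k),
      (B ^ j) (eV (Sum.inr ⟨(k, j), ⟨h1, h2⟩⟩)) = μ2 ^ j • eV (Sum.inl (-(k : ℤ))) := by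
    intro j k h1
    induction j, h1 using Nat.le_induction with
    | base => intro h2; rw [pow_one, hjoin k h2, pow_one]
    | succ j hj ih =>
      intro h2
      rw [pow_succ, mul_apply_eq_comp, hbranch k (j + 1) (by omega) h2, map_smul]
      have := ih (by omega)
      simp only [Nat.add_sub_cancel]
      rw [this, smul_smul, pow_succ']
  have hto0 : ∀ p : ℕ, ToZero B (eV (Sum.inl (-(p : ℤ)))) := by
    intro p
    refine ToZero.of_small fun ε hε => ?_
    have hr : ‖μ1 / μ2‖ < 1 := by
      rw [norm_div, div_lt_one (norm_pos_iff.2 hm2)]; exact hμ12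
    obtain ⟨N, hN⟩ := exists_pow_lt_of_lt_one hε hr
    refine ⟨N + 1, (μ1 / μ2) ^ (N + 1) •
      eV (Sum.inr ⟨(p + (N + 1), N + 1), ⟨by simp, by simp⟩⟩), ?_, ?_⟩
    · rw [norm_smul, eV_norm, mul_one, norm_pow]
      refine lt_of_le_of_lt (pow_le_pow_of_le_one (norm_nonneg _) hr.le (Nat.le_succ N)) hN
    · rw [map_sub, map_smul, hpowspine, hpowbranch (N + 1) (p + (N + 1)) (by omega) (by omega),
        smul_smul, ← mul_pow, div_mul_cancel₀ _ hm2, sub_eq_zero]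
      congr 3
      push_cast; ring
  have hto1 : ∀ (q : ℕ) (n : ℤ), n ≤ q → ToZero B (eV (Sum.inl n)) := by
    intro q
    induction q with
    | zero =>
      intro n hn
      obtain ⟨p, hp⟩ := Int.eq_ofNat_of_zero_le (show 0 ≤ -n by simpa using hn)
      have := hto0 p
      rwa [← hp, neg_neg] at this
    | succ q ih =>
      intro n hn
      refine ToZero.of_map ?_
      rw [hspine]
      exact (ih (n - 1) (by push_cast at hn; omega)).smul _
  have hto : ∀ n : ℤ, ToZero B (eV (Sum.inl n)) := fun n =>
    hto1 n.toNat n (Int.self_le_toNat n)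
  have hfrom : ∀ n : ℤ, FromZero B (eV (Sum.inl n)) := by
    intro n δ hδ
    have hr : ‖μ1⁻¹‖ < 1 := by rw [norm_inv]; exact inv_lt_one_of_one_lt₀ hμ1
    obtain ⟨N, hN⟩ := exists_pow_lt_of_lt_one hδ hr
    refine ⟨N + 1, fun l => if l ≤ N then μ1⁻¹ ^ l • eV (Sum.inl (n + l)) else 0, by simp,
      fun l hl => ?_, fun l => ?_⟩
    · simp only [show ¬ l ≤ N by omega, if_false]
    · rcases lt_trichotomy l N with h | h | h
      · simp only [h.le, show l + 1 ≤ N from h, if_true]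
        rw [map_smul, hspine, smul_smul, pow_succ, mul_assoc, inv_mul_cancel₀ hm1, mul_one]
        have : n + ((l + 1 : ℕ) : ℤ) - 1 = n + l := by push_cast; ring
        rw [this, sub_self, norm_zero]
        exact hδ
      · subst h
        simp only [le_refl, if_true, show ¬ l + 1 ≤ l by omega, if_false, map_zero, sub_zero]
        rw [norm_smul, eV_norm, mul_one, norm_pow]
        exact hN
      · simp only [show ¬ l ≤ N by omega, show ¬ l + 1 ≤ N by omega, if_false, map_zero, sub_zero,
          norm_zero]
        exact hδ
  have hspan : ∀ g ∈ (Submodule.span ℂ (Set.range fun n : ℤ => eV (Sum.inl n)) : Set E),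
      ChainRecVec B g := by
    intro g hg
    have : ToZero B g ∧ FromZero B g := by
      refine Submodule.span_induction (p := fun g _ => ToZero B g ∧ FromZero B g)
        ?_ ?_ ?_ ?_ hg
      · rintro _ ⟨n, rfl⟩
        exact ⟨hto n, hfrom n⟩
      · exact ⟨ToZero.zero B, FromZero.zero B⟩
      · intro x y _ _ hx hy
        exact ⟨hx.1.add hy.1, hx.2.add hy.2⟩
      · intro c x _ hx
        exact ⟨hx.1.smul c, hx.2.smul c⟩
    exact chainRec_of_zero this.1 this.2
  apply Set.Subset.antisymm
  · intro f hf
    have hz : ∀ p : TreeBranch, f (Sum.inr p) = 0 := by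
      intro p
      by_contra hne
      exact part1 f ⟨p, hne⟩ hf
    refine mem_closure_of_tendsto (eV_hasSum f) (Filter.Eventually.of_forall fun s => ?_)
    refine Submodule.sum_mem _ fun v _ => ?_
    rcases v with n | p
    · exact Submodule.smul_mem _ _ (Submodule.subset_span ⟨n, rfl⟩)
    · rw [hz p, zero_smul]
      exact Submodule.zero_mem _
  · intro f hf
    exact chainRec_of_mem_closure hspan hf
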